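/- Lemma F.1 (equivalence of Gaussian purifications without symmetry, covariance-matrix level): Let n = n_A + n_B and let σ₁, σ₂ be (2n×2n) real symmetric positive-definite matrices that are pure with respect to the symplectic form Ω_n = Ω_{n_A} ⊕ Ω_{n_B} (i.e., σ_k * Ω_n * σ_k * Ω_n = −1 for k = 1,2). Suppose the top-left 2n_A×2n_A blocks of σ₁ and σ₂ are equal. Then there exists a symplectic (2n_B×2n_B) matrix V_B such that (1_{2n_A} ⊕ V_B) * σ₁ * (1_{2n_A} ⊕ V_B)ᵀ = σ₂, where ⊕ denotes the block-diagonal direct sum. -/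

import Mathlib

open Matrix

noncomputable section

/-- The 2×2 standard symplectic form `Ω₁ = !![0,1; -1,0]`. -/
def Omega1 : Matrix (Fin 2) (Fin 2) ℝ := !![0, 1; -1, 0]

/-- The 2n×2n standard symplectic form `Ω_n`, a block-diagonal matrix with `n` copies of `Ω₁`. -/
def OmegaN (n : ℕ) : Matrix (Fin 2 × Fin n) (Fin 2 × Fin n) ℝ :=
  Matrix.blockDiagonal fun _ => Omega1

/-- A real 2n×2n matrix is symplectic if `S * Ω_n * Sᵀ = Ω_n`. -/
def IsSymplectic {n : ℕ} (S : Matrix (Fin 2 × Fin n) (Fin 2 × Fin n) ℝ) : Prop :=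
  S * OmegaN n * Sᵀ = OmegaN n

/-- The symplectic form `Ω_{n_A} ⊕ Ω_{n_B}` on a composite system. -/
def OmegaAB (nA nB : ℕ) :
    Matrix ((Fin 2 × Fin nA) ⊕ (Fin 2 × Fin nB)) ((Fin 2 × Fin nA) ⊕ (Fin 2 × Fin nB)) ℝ :=
  Matrix.fromBlocks (OmegaN nA) 0 0 (OmegaN nB)

section helpers

lemma pe_gram_zero {N ι : Type} [Fintype N] [DecidableEq N] [Fintype ι]
    {B : Matrix N N ℝ} (hB : B.PosDef) (Y : Matrix N ι ℝ) (h : Yᵀ * B * Y = 0) : Y = 0 := by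
  have key : ∀ j, (fun i => Y i j) = 0 := by
    intro j
    by_contra hne
    have h1 := hB.dotProduct_mulVec_pos hne
    have h2 : (Yᵀ * B * Y) j j = 0 := by rw [h]; rfl
    have h3 : (Yᵀ * B * Y) j j = star (fun i => Y i j) ⬝ᵥ (B *ᵥ (fun i => Y i j)) := by
      rw [Matrix.mul_assoc]
      simp [Matrix.mul_apply, dotProduct, mulVec]
    rw [← h3, h2] at h1
    exact lt_irrefl _ h1
  ext i j
  exact congrFun (key j) i

lemma pe_left_inv {N ι : Type} [Fintype N] [DecidableEq N] [Fintype ι] [DecidableEq ι]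
    (A : Matrix ι N ℝ) (h : ∀ v, A *ᵥ v = 0 → v = 0) : ∃ L : Matrix N ι ℝ, L * A = 1 := by
  obtain ⟨g, hg⟩ := LinearMap.exists_leftInverse_of_injective (Matrix.toLin' A)
    (by rw [LinearMap.ker_eq_bot']; intro v hv; exact h v (by simpa using hv))
  refine ⟨LinearMap.toMatrix' g, ?_⟩
  have := congrArg LinearMap.toMatrix' hg
  rw [LinearMap.toMatrix'_comp] at this
  simpa using this

/-- Base case. -/
lemma pe_base {N ι : Type} [Fintype N] [DecidableEq N] [Fintype ι] [DecidableEq ι]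
    {B₁ B₂ K₁ K₂ : Matrix N N ℝ} (hB₁ : B₁.PosDef) (hB₂ : B₂.PosDef)
    (hs₁ : B₁ᵀ = B₁)
    (F₁ F₂ : Matrix N ι ℝ) (M : Matrix ι ι ℝ)
    (hG : F₁ᵀ * B₁ * F₁ = F₂ᵀ * B₂ * F₂)
    (hM₁ : K₁ * F₁ = F₁ * M) (hM₂ : K₂ * F₂ = F₂ * M)
    (h : ∀ v, (F₁ᵀ * B₁) *ᵥ v = 0 → v = 0) :
    ∃ S : Matrix N N ℝ, Sᵀ * B₂ * S = B₁ ∧ S * K₁ = K₂ * S ∧ S * F₁ = F₂ := by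
  obtain ⟨L, hL⟩ := pe_left_inv _ h
  have h1 : B₁ * (F₁ * Lᵀ) = 1 := by
    have := congrArg Matrix.transpose hL
    simpa [Matrix.transpose_mul, hs₁, Matrix.mul_assoc] using this
  have h2 : F₁ * (Lᵀ * B₁) = 1 := by
    rw [← Matrix.mul_assoc]; exact mul_eq_one_comm.mp h1
  set R := Lᵀ * B₁ with hR
  have hF : F₂ * R * F₁ = F₂ := by
    have h3 : F₂ * (R * F₁ - 1) = 0 := by
      apply pe_gram_zero hB₂
      have h4 : F₁ * (R * F₁ - 1) = 0 := by
        rw [Matrix.mul_sub, ← Matrix.mul_assoc, h2]; simp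
      calc (F₂ * (R * F₁ - 1))ᵀ * B₂ * (F₂ * (R * F₁ - 1))
          = (R * F₁ - 1)ᵀ * (F₂ᵀ * B₂ * F₂) * (R * F₁ - 1) := by
            rw [Matrix.transpose_mul]; simp only [Matrix.mul_assoc]
        _ = (R * F₁ - 1)ᵀ * (F₁ᵀ * B₁) * (F₁ * (R * F₁ - 1)) := by
            rw [← hG]; simp only [Matrix.mul_assoc]
        _ = 0 := by rw [h4]; simp
    rw [Matrix.mul_sub, ← Matrix.mul_assoc, sub_eq_zero] at h3
    simpa using h3
  refine ⟨F₂ * R, ?_, ?_, hF⟩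
  · calc (F₂ * R)ᵀ * B₂ * (F₂ * R) = Rᵀ * (F₂ᵀ * B₂ * F₂) * R := by
          rw [Matrix.transpose_mul]; simp only [Matrix.mul_assoc]
      _ = (F₁ * R)ᵀ * B₁ * (F₁ * R) := by
          rw [← hG, Matrix.transpose_mul F₁ R]; simp only [Matrix.mul_assoc]
      _ = B₁ := by rw [h2]; simp
  · calc F₂ * R * K₁ = F₂ * R * (K₁ * (F₁ * R)) := by rw [h2, Matrix.mul_one]
      _ = F₂ * R * (K₁ * F₁) * R := by simp only [Matrix.mul_assoc]
      _ = (F₂ * R * F₁) * M * R := by rw [hM₁]; simp only [Matrix.mul_assoc]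
      _ = K₂ * (F₂ * R) := by rw [hF, ← hM₂]; simp only [Matrix.mul_assoc]

/-- Normalised complement column. -/
lemma pe_unit {N ι : Type} [Fintype N] [DecidableEq N] [Fintype ι]
    {B : Matrix N N ℝ} (hB : B.PosDef) (F : Matrix N ι ℝ)
    (h : ¬ ∀ v, (Fᵀ * B) *ᵥ v = 0 → v = 0) :
    ∃ u : Matrix N Unit ℝ, Fᵀ * B * u = 0 ∧ uᵀ * B * u = 1 := by
  push Not at h
  obtain ⟨v, hv, hne⟩ := h
  have hpos : 0 < v ⬝ᵥ (B *ᵥ v) := by simpa using hB.dotProduct_mulVec_pos hne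
  set c := v ⬝ᵥ (B *ᵥ v) with hc
  refine ⟨(Real.sqrt c)⁻¹ • Matrix.replicateCol Unit v, ?_, ?_⟩
  · rw [Matrix.mul_smul, ← Matrix.replicateCol_mulVec, hv]; ext; simp
  · have h5 : (Matrix.replicateCol Unit v)ᵀ * B * Matrix.replicateCol Unit v = c • 1 := by
      rw [Matrix.mul_assoc, ← Matrix.replicateCol_mulVec]
      ext i j
      simp [Matrix.mul_apply, hc, dotProduct]
    rw [Matrix.transpose_smul, Matrix.smul_mul, Matrix.smul_mul, Matrix.mul_smul, h5, smul_smul,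
      smul_smul]
    have : (Real.sqrt c)⁻¹ * (Real.sqrt c)⁻¹ * c = 1 := by
      have h6 := Real.mul_self_sqrt hpos.le
      have h7 : Real.sqrt c ≠ 0 := (Real.sqrt_pos.mpr hpos).ne'
      field_simp
      nlinarith
    rw [this, one_smul]

/-- Gram data of an extended frame. -/
lemma pe_ext {N ι : Type} [Fintype N] [DecidableEq N] [Fintype ι] [DecidableEq ι]
    {B K : Matrix N N ℝ} (hs : Bᵀ = B) (hK : Kᵀ * B = -(B * K))
    (F : Matrix N ι ℝ) (M : Matrix ι ι ℝ) (hM : K * F = F * M)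
    (hJ : ∀ v : Matrix N Unit ℝ, Fᵀ * B * v = 0 → K * (K * v) = -v)
    (u : Matrix N Unit ℝ) (hu : Fᵀ * B * u = 0) (hu1 : uᵀ * B * u = 1) :
    (fromCols F (fromCols u (K * u)))ᵀ * B * fromCols F (fromCols u (K * u)) =
      fromBlocks (Fᵀ * B * F) 0 0 1 ∧
    K * fromCols F (fromCols u (K * u)) = fromCols F (fromCols u (K * u)) *
      (fromBlocks M 0 0 (fromBlocks 0 (-1) 1 0) :
        Matrix (ι ⊕ (Unit ⊕ Unit)) (ι ⊕ (Unit ⊕ Unit)) ℝ) := by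
  have a1 : Fᵀ * B * (K * u) = 0 := by
    have : Fᵀ * (Kᵀ * B) * u = 0 := by
      rw [← Matrix.mul_assoc, ← Matrix.transpose_mul, hM, Matrix.transpose_mul, Matrix.mul_assoc,
        Matrix.mul_assoc, ← Matrix.mul_assoc Fᵀ, hu, Matrix.mul_zero]
    rw [hK] at this
    simpa [Matrix.mul_assoc] using this
  have a2 : uᵀ * B * (K * u) = 0 := by
    have h1 : (uᵀ * B * (K * u))ᵀ = -(uᵀ * B * (K * u)) := by
      rw [Matrix.transpose_mul, Matrix.transpose_mul, Matrix.transpose_mul, hs,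
        Matrix.transpose_transpose, ← Matrix.mul_assoc, Matrix.mul_assoc uᵀ, hK]
      simp [Matrix.mul_assoc]
    ext i j
    have h2 := congrFun (congrFun h1 i) j
    simp only [Matrix.transpose_apply, Matrix.neg_apply] at h2
    cases i; cases j
    simp only [Matrix.zero_apply]
    linarith
  have tr : ∀ {α β : Type} (X : Matrix N α ℝ) (Y : Matrix N β ℝ), Xᵀ * B * Y = 0 →
      Yᵀ * B * X = 0 := by
    intro α β X Y h
    have := congrArg Matrix.transpose h
    simpa [Matrix.transpose_mul, hs, Matrix.mul_assoc] using this
  have a3 : (K * u)ᵀ * B * (K * u) = 1 := by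
    rw [Matrix.transpose_mul, Matrix.mul_assoc uᵀ, hK]
    have := hJ u hu
    simp only [Matrix.mul_neg, Matrix.neg_mul, Matrix.mul_assoc]
    rw [this]
    simpa [Matrix.mul_assoc] using hu1
  constructor
  · have b1 : Fᵀ * B * fromCols u (K * u) = 0 := by
      rw [Matrix.mul_fromCols, hu, a1]; ext i (j | j) <;> rfl
    have b2 : (fromCols u (K * u))ᵀ * B * fromCols u (K * u) = 1 := by
      rw [Matrix.transpose_fromCols, Matrix.fromRows_mul, Matrix.fromRows_mul_fromCols, hu1, a2,
        a3, tr _ _ a2, Matrix.fromBlocks_one]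
    rw [Matrix.transpose_fromCols, Matrix.fromRows_mul, Matrix.fromRows_mul_fromCols, b1, b2,
      tr _ _ b1]
  · rw [Matrix.mul_fromCols, Matrix.mul_fromCols, Matrix.fromCols_mul_fromBlocks,
      Matrix.fromCols_mul_fromBlocks, hM, hJ u hu]
    simp

lemma pe_abstract {N : Type} [Fintype N] [DecidableEq N]
    {B₁ B₂ K₁ K₂ : Matrix N N ℝ} (hB₁ : B₁.PosDef) (hB₂ : B₂.PosDef)
    (hs₁ : B₁ᵀ = B₁) (hs₂ : B₂ᵀ = B₂)
    (hK₁ : K₁ᵀ * B₁ = -(B₁ * K₁)) (hK₂ : K₂ᵀ * B₂ = -(B₂ * K₂)) (k : ℕ) :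
    ∀ (ι : Type) [Fintype ι] [DecidableEq ι]
    (F₁ F₂ : Matrix N ι ℝ) (M : Matrix ι ι ℝ)
    (_ : F₁ᵀ * B₁ * F₁ = F₂ᵀ * B₂ * F₂)
    (_ : K₁ * F₁ = F₁ * M) (_ : K₂ * F₂ = F₂ * M)
    (_ : ∀ v : Matrix N Unit ℝ, F₁ᵀ * B₁ * v = 0 → K₁ * (K₁ * v) = -v)
    (_ : ∀ v : Matrix N Unit ℝ, F₂ᵀ * B₂ * v = 0 → K₂ * (K₂ * v) = -v)
    (_ : Module.finrank ℝ (LinearMap.ker (F₁ᵀ * B₁).mulVecLin) = k),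
    ∃ S : Matrix N N ℝ, Sᵀ * B₂ * S = B₁ ∧ S * K₁ = K₂ * S ∧ S * F₁ = F₂ := by
  induction k using Nat.strong_induction_on with
  | _ k ih =>
  intro ι _ _ F₁ F₂ M hG hM₁ hM₂ hJ₁ hJ₂ hk
  by_cases h1 : ∀ v, (F₁ᵀ * B₁) *ᵥ v = 0 → v = 0
  · exact pe_base hB₁ hB₂ hs₁ F₁ F₂ M hG hM₁ hM₂ h1
  by_cases h2 : ∀ v, (F₂ᵀ * B₂) *ᵥ v = 0 → v = 0
  · obtain ⟨S, hS1, hS2, hS3⟩ := pe_base hB₂ hB₁ hs₂ F₂ F₁ M hG.symm hM₂ hM₁ h2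
    have hdet : IsUnit S.det := by
      have := congrArg Matrix.det hS1
      rw [Matrix.det_mul] at this
      have h3 := hB₂.det_pos
      rw [isUnit_iff_ne_zero]
      intro h0
      rw [h0, mul_zero] at this
      linarith
    have i1 := Matrix.mul_nonsing_inv S hdet
    have i2 := Matrix.nonsing_inv_mul S hdet
    refine ⟨S⁻¹, ?_, ?_, ?_⟩
    · calc (S⁻¹)ᵀ * B₂ * S⁻¹ = (S * S⁻¹)ᵀ * B₁ * (S * S⁻¹) := by
            rw [← hS1, Matrix.transpose_mul]; simp only [Matrix.mul_assoc]
        _ = B₁ := by rw [i1]; simp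
    · calc S⁻¹ * K₁ = S⁻¹ * (K₁ * S) * S⁻¹ := by
            rw [Matrix.mul_assoc, Matrix.mul_assoc, i1, Matrix.mul_one]
        _ = K₂ * S⁻¹ := by rw [← hS2, ← Matrix.mul_assoc, i2, Matrix.one_mul]
    · rw [← hS3, ← Matrix.mul_assoc, i2, Matrix.one_mul]
  obtain ⟨u₁, hu₁, hu₁'⟩ := pe_unit hB₁ F₁ h1
  obtain ⟨u₂, hu₂, hu₂'⟩ := pe_unit hB₂ F₂ h2
  obtain ⟨e1, e1'⟩ := pe_ext hs₁ hK₁ F₁ M hM₁ hJ₁ u₁ hu₁ hu₁'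
  obtain ⟨e2, e2'⟩ := pe_ext hs₂ hK₂ F₂ M hM₂ hJ₂ u₂ hu₂ hu₂'
  have top : ∀ {κ α : Type} (B : Matrix N N ℝ) (X : Matrix N ι ℝ) (Y : Matrix N κ ℝ)
      (v : Matrix N α ℝ), (fromCols X Y)ᵀ * B * v = 0 → Xᵀ * B * v = 0 ∧ Yᵀ * B * v = 0 := by
    intro κ α B X Y v h
    rw [Matrix.transpose_fromCols, Matrix.fromRows_mul, Matrix.fromRows_mul] at h
    constructor
    · ext i j; exact congrFun (congrFun h (Sum.inl i)) j
    · ext i j; exact congrFun (congrFun h (Sum.inr i)) j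
  have hlt : Module.finrank ℝ (LinearMap.ker
      ((fromCols F₁ (fromCols u₁ (K₁ * u₁)))ᵀ * B₁).mulVecLin) < k := by
    rw [← hk]
    apply Submodule.finrank_lt_finrank_of_lt
    have conv : ∀ {κ : Type} (X : Matrix κ N ℝ) (v : N → ℝ),
        X *ᵥ v = 0 ↔ X * replicateCol Unit v = 0 := by
      intro κ X v
      rw [← Matrix.replicateCol_mulVec]
      constructor
      · intro h; rw [h]; ext; simp
      · intro h; ext i; exact congrFun (congrFun h i) ()
    rw [SetLike.lt_iff_le_and_exists]
    constructor
    · intro v hv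
      rw [LinearMap.mem_ker, Matrix.mulVecLin_apply, conv] at hv ⊢
      exact (top _ _ _ _ hv).1
    · have hr : replicateCol Unit (fun i => u₁ i ()) = u₁ := by ext i j; rfl
      refine ⟨fun i => u₁ i (), ?_, ?_⟩
      · rw [LinearMap.mem_ker, Matrix.mulVecLin_apply, conv, hr]
        exact hu₁
      · rw [LinearMap.mem_ker, Matrix.mulVecLin_apply, conv, hr]
        intro hv
        have h3 := (top _ _ _ _ hv).2
        rw [Matrix.transpose_fromCols, Matrix.fromRows_mul, Matrix.fromRows_mul, hu₁'] at h3
        have := congrFun (congrFun h3 (Sum.inl ())) ()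
        simp at this
  obtain ⟨S, hS1, hS2, hS3⟩ := ih _ hlt (ι ⊕ (Unit ⊕ Unit)) (fromCols F₁ (fromCols u₁ (K₁ * u₁)))
    (fromCols F₂ (fromCols u₂ (K₂ * u₂))) _ (by rw [e1, e2, hG]) e1' e2'
    (fun v hv => hJ₁ v (top _ _ _ _ hv).1) (fun v hv => hJ₂ v (top _ _ _ _ hv).1) rfl
  refine ⟨S, hS1, hS2, ?_⟩
  rw [Matrix.mul_fromCols] at hS3
  exact (Matrix.fromCols_inj hS3).1

lemma pe_omega_sq (n : ℕ) : OmegaN n * OmegaN n = -1 := by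
  have : Omega1 * Omega1 = -1 := by
    ext i j; fin_cases i <;> fin_cases j <;> simp [Omega1, Matrix.mul_apply]
  rw [OmegaN, ← Matrix.blockDiagonal_mul, this]
  have h := Matrix.blockDiagonal_neg (fun _ : Fin n => (1 : Matrix (Fin 2) (Fin 2) ℝ))
  have h1 : Matrix.blockDiagonal (fun _ : Fin n => (1 : Matrix (Fin 2) (Fin 2) ℝ)) = 1 :=
    Matrix.blockDiagonal_one
  rw [h1] at h
  exact h

lemma pe_omega_tr (n : ℕ) : (OmegaN n)ᵀ = -OmegaN n := by
  have : Omega1ᵀ = -Omega1 := by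
    ext i j; fin_cases i <;> fin_cases j <;> simp [Omega1]
  rw [OmegaN, Matrix.blockDiagonal_transpose, this]
  exact Matrix.blockDiagonal_neg (fun _ : Fin n => Omega1)

/-- Block data of one pure covariance matrix. -/
lemma pe_blocks {nA nB : ℕ} (A : Matrix (Fin 2 × Fin nA) (Fin 2 × Fin nA) ℝ)
    (C : Matrix (Fin 2 × Fin nA) (Fin 2 × Fin nB) ℝ)
    (D : Matrix (Fin 2 × Fin nB) (Fin 2 × Fin nA) ℝ)
    (B : Matrix (Fin 2 × Fin nB) (Fin 2 × Fin nB) ℝ)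
    (hsymm : (fromBlocks A C D B).IsSymm) (hpd : (fromBlocks A C D B).PosDef)
    (hpure : fromBlocks A C D B * OmegaAB nA nB * fromBlocks A C D B * OmegaAB nA nB = -1) :
    Aᵀ = A ∧ D = Cᵀ ∧ Bᵀ = B ∧ B.PosDef ∧ A.PosDef ∧
    C * OmegaN nB * D = OmegaN nA - A * OmegaN nA * A ∧
    A * OmegaN nA * C = -(C * OmegaN nB * B) ∧
    D * OmegaN nA * A = -(B * OmegaN nB * D) ∧
    D * OmegaN nA * C + B * OmegaN nB * B = OmegaN nB := by
  have hs := hsymm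
  rw [Matrix.IsSymm, Matrix.fromBlocks_transpose, Matrix.fromBlocks_inj] at hs
  obtain ⟨s1, s2, s3, s4⟩ := hs
  have hB : B.PosDef := by
    exact hpd.submatrix (e := Sum.inr) Sum.inr_injective
  have hA : A.PosDef := by
    exact hpd.submatrix (e := Sum.inl) Sum.inl_injective
  have h2 : fromBlocks A C D B * OmegaAB nA nB * fromBlocks A C D B = OmegaAB nA nB := by
    have hO : OmegaAB nA nB * OmegaAB nA nB = -1 := by
      rw [OmegaAB, Matrix.fromBlocks_multiply]
      simp [pe_omega_sq, ← Matrix.fromBlocks_one, Matrix.fromBlocks_neg]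
    have := congrArg (fun X => X * OmegaAB nA nB) hpure
    simp only [Matrix.mul_assoc, hO] at this
    simpa [Matrix.mul_assoc] using this
  rw [OmegaAB, Matrix.fromBlocks_multiply, Matrix.fromBlocks_multiply, Matrix.fromBlocks_inj] at h2
  simp only [Matrix.mul_zero, add_zero, zero_add] at h2
  obtain ⟨t1, t2, t3, t4⟩ := h2
  exact ⟨s1, s3.symm, s4, hB, hA, eq_sub_of_add_eq' t1, eq_neg_of_add_eq_zero_left t2,
    eq_neg_of_add_eq_zero_left t3, t4⟩

/-- On the complement of the frame, `Ω B` is a complex structure. -/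
lemma pe_J {nA nB : ℕ} {A : Matrix (Fin 2 × Fin nA) (Fin 2 × Fin nA) ℝ}
    {C : Matrix (Fin 2 × Fin nA) (Fin 2 × Fin nB) ℝ}
    {B : Matrix (Fin 2 × Fin nB) (Fin 2 × Fin nB) ℝ} (hA : A.PosDef)
    (h7 : A * OmegaN nA * C = -(C * OmegaN nB * B))
    (h9 : Cᵀ * OmegaN nA * C + B * OmegaN nB * B = OmegaN nB)
    (v : Matrix (Fin 2 × Fin nB) Unit ℝ) (hv : (OmegaN nB * Cᵀ)ᵀ * B * v = 0) :
    OmegaN nB * B * (OmegaN nB * B * v) = -v := by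
  have h1 : A * (OmegaN nA * (C * v)) = 0 := by
    rw [Matrix.transpose_mul, pe_omega_tr, Matrix.transpose_transpose, Matrix.mul_neg,
      Matrix.neg_mul, ← h7] at hv
    simpa [Matrix.mul_assoc] using hv
  have hdet : IsUnit A.det := isUnit_iff_ne_zero.mpr hA.det_pos.ne'
  have h2 : OmegaN nA * (C * v) = 0 := by
    have := congrArg (fun X => A⁻¹ * X) h1
    simpa [← Matrix.mul_assoc, Matrix.nonsing_inv_mul A hdet] using this
  have h3 := congrArg (fun X => OmegaN nB * (X * v)) h9
  simp only [Matrix.add_mul, Matrix.mul_assoc, h2, Matrix.mul_zero, zero_add] at h3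
  rw [← Matrix.mul_assoc (OmegaN nB) (OmegaN nB), pe_omega_sq] at h3
  simpa [Matrix.mul_assoc] using h3

end helpers

/-- Lemma F.1: two pure Gaussian covariance matrices on a composite system `AB` with equal
reduced covariance matrices on `A` are related by a symplectic transformation on `B` alone. -/
theorem purification_equivalence (nA nB : ℕ)
    (σ₁ σ₂ : Matrix ((Fin 2 × Fin nA) ⊕ (Fin 2 × Fin nB))
      ((Fin 2 × Fin nA) ⊕ (Fin 2 × Fin nB)) ℝ)
    (hσ₁symm : σ₁.IsSymm) (hσ₁pd : σ₁.PosDef)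
    (hσ₂symm : σ₂.IsSymm) (hσ₂pd : σ₂.PosDef)
    (hσ₁pure : σ₁ * OmegaAB nA nB * σ₁ * OmegaAB nA nB = -1)
    (hσ₂pure : σ₂ * OmegaAB nA nB * σ₂ * OmegaAB nA nB = -1)
    (hblock : σ₁.toBlocks₁₁ = σ₂.toBlocks₁₁) :
    ∃ VB : Matrix (Fin 2 × Fin nB) (Fin 2 × Fin nB) ℝ, IsSymplectic VB ∧
      (Matrix.fromBlocks 1 0 0 VB) * σ₁ * (Matrix.fromBlocks 1 0 0 VB)ᵀ = σ₂ := by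
  obtain ⟨A, C₁, D₁, B₁, rfl⟩ : ∃ A C D B, σ₁ = fromBlocks A C D B :=
    ⟨_, _, _, _, (Matrix.fromBlocks_toBlocks σ₁).symm⟩
  obtain ⟨A', C₂, D₂, B₂, rfl⟩ : ∃ A C D B, σ₂ = fromBlocks A C D B :=
    ⟨_, _, _, _, (Matrix.fromBlocks_toBlocks σ₂).symm⟩
  rw [Matrix.toBlocks_fromBlocks₁₁, Matrix.toBlocks_fromBlocks₁₁] at hblock
  subst hblock
  obtain ⟨-, rfl, s₁, p₁, hA, q₁, r₁, t₁, w₁⟩ := pe_blocks _ _ _ _ hσ₁symm hσ₁pd hσ₁pure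
  obtain ⟨-, rfl, s₂, p₂, -, q₂, r₂, t₂, w₂⟩ := pe_blocks _ _ _ _ hσ₂symm hσ₂pd hσ₂pure
  have hsq := pe_omega_sq nB
  have htr := pe_omega_tr nB
  have hK : ∀ B : Matrix (Fin 2 × Fin nB) (Fin 2 × Fin nB) ℝ, Bᵀ = B →
      (OmegaN nB * B)ᵀ * B = -(B * (OmegaN nB * B)) := by
    intro B hB
    rw [Matrix.transpose_mul, hB, htr]; simp [Matrix.mul_assoc]
  have hG : ∀ (C : Matrix (Fin 2 × Fin nA) (Fin 2 × Fin nB) ℝ)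
      (B : Matrix (Fin 2 × Fin nB) (Fin 2 × Fin nB) ℝ),
      C * OmegaN nB * Cᵀ = OmegaN nA - A * OmegaN nA * A →
      Cᵀ * OmegaN nA * A = -(B * OmegaN nB * Cᵀ) →
      (OmegaN nB * Cᵀ)ᵀ * B * (OmegaN nB * Cᵀ) =
        (OmegaN nA - A * OmegaN nA * A) * (OmegaN nA * A) := by
    intro C B h1 h2
    rw [← h1, Matrix.transpose_mul, htr, Matrix.transpose_transpose]
    have : C * OmegaN nB * (Cᵀ * OmegaN nA * A) = C * OmegaN nB * -(B * OmegaN nB * Cᵀ) := by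
      rw [h2]
    simp only [Matrix.mul_assoc, Matrix.mul_neg, Matrix.neg_mul] at this ⊢
    rw [this]
  have hM : ∀ (C : Matrix (Fin 2 × Fin nA) (Fin 2 × Fin nB) ℝ)
      (B : Matrix (Fin 2 × Fin nB) (Fin 2 × Fin nB) ℝ),
      Cᵀ * OmegaN nA * A = -(B * OmegaN nB * Cᵀ) →
      (OmegaN nB * B) * (OmegaN nB * Cᵀ) = (OmegaN nB * Cᵀ) * -(OmegaN nA * A) := by
    intro C B h2
    have := congrArg (fun X : Matrix (Fin 2 × Fin nB) (Fin 2 × Fin nA) ℝ => OmegaN nB * -X) h2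
    simp only [neg_neg] at this
    simp only [Matrix.mul_assoc, Matrix.mul_neg] at this ⊢
    exact this.symm
  obtain ⟨S, hS1, hS2, hS3⟩ := pe_abstract p₁ p₂ s₁ s₂ (hK _ s₁) (hK _ s₂) _ _
    (OmegaN nB * C₁ᵀ) (OmegaN nB * C₂ᵀ) (-(OmegaN nA * A))
    (by rw [hG _ _ q₁ t₁, hG _ _ q₂ t₂]) (hM _ _ t₁) (hM _ _ t₂)
    (fun v hv => pe_J hA r₁ w₁ v hv) (fun v hv => pe_J hA r₂ w₂ v hv) rfl
  have hdB : IsUnit B₁.det := isUnit_iff_ne_zero.mpr p₁.det_pos.ne'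
  have hdet : IsUnit S.det := by
    rw [isUnit_iff_ne_zero]
    intro h0
    have := congrArg Matrix.det hS1
    rw [Matrix.det_mul, h0, mul_zero] at this
    exact p₁.det_pos.ne this
  have i1 := Matrix.mul_nonsing_inv S hdet
  have i2 := Matrix.nonsing_inv_mul S hdet
  have j1 : Sᵀ * (S⁻¹)ᵀ = 1 := by rw [← Matrix.transpose_mul, i2]; simp
  have j2 : (S⁻¹)ᵀ * Sᵀ = 1 := by rw [← Matrix.transpose_mul, i1]; simp
  -- `S` is symplectic
  have hSp : S * OmegaN nB * Sᵀ = OmegaN nB := by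
    have h1 : (S⁻¹)ᵀ * B₁ = B₂ * S := by
      rw [← hS1, Matrix.mul_assoc, ← Matrix.mul_assoc, j2, Matrix.one_mul]
    have h2 : S * OmegaN nB * B₁ = OmegaN nB * (S⁻¹)ᵀ * B₁ := by
      rw [Matrix.mul_assoc, hS2, Matrix.mul_assoc, Matrix.mul_assoc, h1]
    have h3 : S * OmegaN nB = OmegaN nB * (S⁻¹)ᵀ := by
      have := congrArg (fun X => X * B₁⁻¹) h2
      simpa [Matrix.mul_assoc, Matrix.mul_nonsing_inv B₁ hdB] using this
    rw [h3, Matrix.mul_assoc, j2, Matrix.mul_one]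
  have hSO : S * OmegaN nB = OmegaN nB * (S⁻¹)ᵀ := by
    have := congrArg (fun X => X * (S⁻¹)ᵀ) hSp
    simpa only [Matrix.mul_assoc, j1, Matrix.mul_one] using this
  have hV : (S⁻¹)ᵀ * C₁ᵀ = C₂ᵀ := by
    rw [← Matrix.mul_assoc, hSO] at hS3
    have := congrArg (fun X => OmegaN nB * X) hS3
    simp only [← Matrix.mul_assoc, hsq] at this
    simpa [Matrix.mul_assoc] using this
  have hVt : C₁ * S⁻¹ = C₂ := by
    have := congrArg Matrix.transpose hV
    simpa [Matrix.transpose_mul] using this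
  refine ⟨(S⁻¹)ᵀ, ?_, ?_⟩
  · rw [IsSymplectic, Matrix.transpose_transpose]
    -- invert `S Ω Sᵀ = Ω`, using `Ω⁻¹ = -Ω`
    have h1 : S * (OmegaN nB * Sᵀ * -OmegaN nB) = 1 := by
      rw [← Matrix.mul_assoc, ← Matrix.mul_assoc, hSp, Matrix.mul_neg, hsq, neg_neg]
    have h2 : S⁻¹ = OmegaN nB * Sᵀ * -OmegaN nB := Matrix.inv_eq_right_inv h1
    calc (S⁻¹)ᵀ * OmegaN nB * S⁻¹
        = (S⁻¹)ᵀ * (OmegaN nB * OmegaN nB) * Sᵀ * -OmegaN nB := by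
          rw [h2]; simp only [Matrix.mul_assoc]
      _ = OmegaN nB := by
          rw [hsq]; simp [j2]
  · rw [Matrix.fromBlocks_transpose, Matrix.fromBlocks_multiply, Matrix.fromBlocks_multiply]
    have hBB : (S⁻¹)ᵀ * B₁ * S⁻¹ = B₂ := by
      rw [← hS1]
      calc (S⁻¹)ᵀ * (Sᵀ * B₂ * S) * S⁻¹ = ((S⁻¹)ᵀ * Sᵀ) * B₂ * (S * S⁻¹) := by
            simp only [Matrix.mul_assoc]
        _ = B₂ := by rw [i1, j2]; simp
    simp [hV, hVt, hBB]
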